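/- arXiv:1301.6479 — 4 statements merged into one kernel-verified Lean document; each statement's English description precedes it below -/
import Mathlib

section
/- Let S be a sublanguage of a finite relational language L, let O be a set of L-sentences none of which contains an equality atom, and let q be an L-formula with k free variables that is a union of conjunctive queries. For a finite nonempty S-structure D, call a tuple a ∈ D^k a certain answer of q on D if for every finite nonempty L-structure P that satisfies all sentences of O and every injective S-homomorphism ι from D to the S-reduct of P, the formula q is satisfied in P under the assignment i ↦ ι(aᵢ). Then certain answers are preserved by homomorphisms: for every S-homomorphism h : D₁ → D₂ between finite nonempty S-structures and every tuple a ∈ D₁^k that is a certain answer of q on D₁, the tuple h ∘ a is a certain answer of q on D₂. -/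
open FirstOrder

/-- A bounded formula is equality-free if its construction uses no equality atoms. -/
def EqualityFree {L : Language} {α : Type*} : {n : ℕ} → L.BoundedFormula α n → Prop
  | _, .falsum => True
  | _, .equal _ _ => False
  | _, .rel _ _ => True
  | _, .imp f g => EqualityFree f ∧ EqualityFree g
  | _, .all f => EqualityFree f

/-- A bounded formula is a union of conjunctive queries (UCQ) if it is built from atomic
formulas (relation atoms and equalities) using only conjunction, disjunction, and
existential quantification. -/
inductive IsUCQ {L : Language} {α : Type*} : {n : ℕ} → L.BoundedFormula α n → Prop
  | equal {n} (t₁ t₂ : L.Term (α ⊕ Fin n)) : IsUCQ (.equal t₁ t₂)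
  | rel {n l : ℕ} (R : L.Relations l) (ts : Fin l → L.Term (α ⊕ Fin n)) : IsUCQ (.rel R ts)
  | inf {n} {f g : L.BoundedFormula α n} : IsUCQ f → IsUCQ g → IsUCQ (f ⊓ g)
  | sup {n} {f g : L.BoundedFormula α n} : IsUCQ f → IsUCQ g → IsUCQ (f ⊔ g)
  | ex {n} {f : L.BoundedFormula α (n + 1)} : IsUCQ f → IsUCQ f.ex

/-- `a` is a certain answer of `q` on the `S`-structure `D` given the ontology `O`:
for every finite nonempty `L`-structure `P` satisfying all sentences of `O` and every
injective `S`-homomorphism `ι` from `D` to the `S`-reduct of `P` (along the sublanguage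
inclusion `φ : S →ᴸ L`), the formula `q` is realized in `P` under `i ↦ ι (a i)`. -/
def CertainAnswer {S L : Language} (φ : S →ᴸ L) (O : Set L.Sentence) {k : ℕ}
    (q : L.Formula (Fin k)) (D : Type) [S.Structure D] (a : Fin k → D) : Prop :=
  ∀ (P : Type) [Finite P] [Nonempty P] [L.Structure P],
    (∀ σ ∈ O, P ⊨ σ) →
      letI : S.Structure P := φ.reduct P
      ∀ ι : D →[S] P,
        Function.Injective ι → q.Realize (fun i => ι (a i))

/-- The blow-up of `P` by `D`: relations are pulled back along the first projection. -/
@[reducible]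
def blowup (L : Language) [L.IsRelational] (P D : Type) [L.Structure P] :
    L.Structure (P × D) where
  funMap := fun f _ => isEmptyElim f
  RelMap := fun R xs => Language.Structure.RelMap R (fun i => (xs i).1)

theorem blowup_term {L : Language} [L.IsRelational] {P D : Type} [L.Structure P]
    {β : Type*} (t : L.Term β) (v : β → P × D) :
    (@Language.Term.realize L (P × D) (blowup L P D) β v t).1
      = t.realize (fun i => (v i).1) := by
  cases t with
  | var i => rfl
  | func f ts => exact isEmptyElim f

theorem fst_elim {P D α : Type*} {n : ℕ} (v : α → P × D) (xs : Fin n → P × D) :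
    (fun i => (Sum.elim v xs i).1) = Sum.elim (fun i => (v i).1) (fun i => (xs i).1) := by
  funext i; cases i <;> rfl

theorem fst_snoc {P D : Type*} {n : ℕ} (xs : Fin n → P × D) (p : P × D) :
    (fun i => (Fin.snoc (α := fun _ => P × D) xs p i).1)
      = Fin.snoc (α := fun _ => P) (fun i => (xs i).1) p.1 := by
  funext i
  refine Fin.lastCases ?_ (fun j => ?_) i <;> simp

theorem blowup_equalityFree {L : Language} [L.IsRelational] {P D : Type} [L.Structure P]
    [Nonempty D] {α : Type*} {n : ℕ} (f : L.BoundedFormula α n) (hf : EqualityFree f)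
    (v : α → P × D) (xs : Fin n → P × D) :
    @Language.BoundedFormula.Realize L (P × D) (blowup L P D) α n f v xs
      ↔ f.Realize (fun i => (v i).1) (fun i => (xs i).1) := by
  let _ := blowup L P D
  induction f with
  | falsum => exact Iff.rfl
  | equal t₁ t₂ => exact hf.elim
  | rel R ts =>
    simp only [Language.BoundedFormula.Realize]
    change Language.Structure.RelMap R (fun i => (Language.Term.realize (M := P × D) (Sum.elim v xs) (ts i)).1) ↔ _
    simp only [blowup_term, fst_elim]
  | imp f g ihf ihg =>
    simp only [Language.BoundedFormula.realize_imp]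
    exact imp_congr (ihf hf.1 _) (ihg hf.2 _)
  | all f ih =>
    simp only [Language.BoundedFormula.realize_all]
    constructor
    · intro H p
      obtain ⟨d⟩ := ‹Nonempty D›
      have := (ih hf _).1 (H (p, d))
      rwa [fst_snoc] at this
    · intro H p
      refine (ih hf _).2 ?_
      rw [fst_snoc]
      exact H p.1

theorem blowup_ucq {L : Language} [L.IsRelational] {P D : Type} [L.Structure P]
    {α : Type*} {n : ℕ} (f : L.BoundedFormula α n) (hf : IsUCQ f)
    (v : α → P × D) (xs : Fin n → P × D)
    (H : @Language.BoundedFormula.Realize L (P × D) (blowup L P D) α n f v xs) :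
    f.Realize (fun i => (v i).1) (fun i => (xs i).1) := by
  let _ := blowup L P D
  induction hf with
  | equal t₁ t₂ =>
    simp only [Language.BoundedFormula.Realize] at H ⊢
    have := congrArg Prod.fst H
    simpa only [blowup_term, fst_elim] using this
  | rel R ts =>
    simp only [Language.BoundedFormula.Realize] at H ⊢
    change Language.Structure.RelMap R (fun i => (Language.Term.realize (M := P × D) (Sum.elim v xs) (ts i)).1) at H
    simpa only [blowup_term, fst_elim] using H
  | inf _ _ ihf ihg =>
    rw [Language.BoundedFormula.realize_inf] at H ⊢
    exact ⟨ihf _ H.1, ihg _ H.2⟩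
  | sup _ _ ihf ihg =>
    rw [Language.BoundedFormula.realize_sup] at H ⊢
    exact H.imp (ihf _) (ihg _)
  | ex _ ih =>
    rw [Language.BoundedFormula.realize_ex] at H ⊢
    obtain ⟨p, hp⟩ := H
    have := ih _ hp
    rw [fst_snoc] at this
    exact ⟨p.1, this⟩

/-- Let `S` be a sublanguage of a finite relational language `L` (given
by an injective language homomorphism `φ : S →ᴸ L`), `O` a set of equality-free
`L`-sentences, and `q` an `L`-formula with `k` free variables that is a union of
conjunctive queries.  Then certain answers are preserved by homomorphisms: for every
`S`-homomorphism `h : D₁ → D₂` of finite nonempty `S`-structures and every certain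
answer `a` of `q` on `D₁`, the tuple `h ∘ a` is a certain answer of `q` on `D₂`. -/
theorem certainAnswer_preserved_by_hom
    (S L : Language) [L.IsRelational] [Finite L.Symbols] [S.IsRelational]
    (φ : S →ᴸ L) (hφ : φ.Injective)
    (O : Set L.Sentence) (hO : ∀ σ ∈ O, EqualityFree σ)
    (k : ℕ) (q : L.Formula (Fin k)) (hq : IsUCQ q)
    (D₁ D₂ : Type) [Finite D₁] [Nonempty D₁] [S.Structure D₁]
    [Finite D₂] [Nonempty D₂] [S.Structure D₂]
    (h : D₁ →[S] D₂) (a : Fin k → D₁)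
    (ha : CertainAnswer φ O q D₁ a) :
    CertainAnswer φ O q D₂ (fun i => h (a i)) := by
  intro P _ _ _ hP
  letI iP : S.Structure P := φ.reduct P
  intro ι hι
  letI iL : L.Structure (P × D₁) := blowup L P D₁
  have hP' : ∀ σ ∈ O, (P × D₁) ⊨ σ := by
    intro σ hσ
    have h1 := hP σ hσ
    unfold Language.Sentence.Realize Language.Formula.Realize at h1 ⊢
    rw [blowup_equalityFree σ (hO σ hσ)]
    convert h1
  letI iS : S.Structure (P × D₁) := φ.reduct (P × D₁)
  let ι' : D₁ →[S] (P × D₁) :=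
    { toFun := fun d => (ι (h d), d)
      map_fun' := fun f _ => isEmptyElim f
      map_rel' := fun R x hx => ι.map_rel R _ (h.map_rel R _ hx) }
  have key := ha (P × D₁) hP' ι' (fun x y hxy => congrArg Prod.snd hxy)
  have := blowup_ucq q hq _ _ key
  unfold Language.Formula.Realize
  convert this
  rfl
end

section
/- Let L be a finite relational language and F a finite set of finite nonempty L-structures that are pairwise homomorphically incomparable. If coCSP(F) is FO-definable, then coCSP(B) is FO-definable for every B ∈ F. -/
open FirstOrder

namespace CoCSPAux
open FirstOrder.Language

/-- The disjoint union of two structures in a relational language. -/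
@[reducible] def sumStr (L : Language) [L.IsRelational] (D B : Type)
    [L.Structure D] [L.Structure B] : L.Structure (D ⊕ B) where
  funMap := fun f _ => isEmptyElim f
  RelMap := fun R x =>
    (∃ y : _ → D, x = Sum.inl ∘ y ∧ Structure.RelMap R y) ∨
    (∃ y : _ → B, x = Sum.inr ∘ y ∧ Structure.RelMap R y)

/-- The element of the disjoint union selected by a type `c` and a candidate `d`. -/
def pick {D B : Type} (c : Option B) (d : D) : D ⊕ B :=
  match c with
  | none => Sum.inl d
  | some b => Sum.inr b

lemma term_var (L : Language) [L.IsRelational] {n : ℕ} (t : L.Term (Empty ⊕ Fin n)) :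
    ∃ k : Fin n, t = Term.var (Sum.inr k) := by
  cases t with
  | var x =>
    rcases x with x | x
    · exact x.elim
    · exact ⟨x, rfl⟩
  | func f _ => exact isEmptyElim f

lemma translate (L : Language) [L.IsRelational] (B : Type) [Finite B] [L.Structure B]
    {n : ℕ} (φ : L.BoundedFormula Empty n) : ∀ (c : Fin n → Option B),
    ∃ ψ : L.BoundedFormula Empty n,
      ∀ (D : Type) [Nonempty D] [L.Structure D] (v : Empty → D) (w : Empty → D ⊕ B)
        (xs : Fin n → D),
        ψ.Realize v xs ↔
          @BoundedFormula.Realize L (D ⊕ B) (sumStr L D B) _ _ φ w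
            (fun k => pick (c k) (xs k)) := by
  classical
  induction φ with
  | falsum => exact fun c => ⟨⊥, fun D _ _ v w xs => Iff.rfl⟩
  | @equal n t₁ t₂ =>
    intro c
    obtain ⟨k₁, rfl⟩ := term_var L t₁
    obtain ⟨k₂, rfl⟩ := term_var L t₂
    rcases h₁ : c k₁ with _ | b₁ <;> rcases h₂ : c k₂ with _ | b₂
    · refine ⟨.equal (.var (.inr k₁)) (.var (.inr k₂)), fun D _ _ v w xs => ?_⟩
      simp [BoundedFormula.Realize, pick, h₁, h₂]
    · refine ⟨⊥, fun D _ _ v w xs => ?_⟩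
      simp [BoundedFormula.Realize, pick, h₁, h₂]
    · refine ⟨⊥, fun D _ _ v w xs => ?_⟩
      simp [BoundedFormula.Realize, pick, h₁, h₂]
    · refine ⟨if b₁ = b₂ then ⊤ else ⊥, fun D _ _ v w xs => ?_⟩
      by_cases hb : b₁ = b₂ <;>
      simp [BoundedFormula.Realize, pick, h₁, h₂, hb]
  | @rel n l R ts =>
    intro c
    choose k hk using fun i => term_var L (ts i)
    obtain rfl : ts = fun i => Term.var (Sum.inr (k i)) := funext hk
    refine ⟨(if ∀ i, c (k i) = none then .rel R (fun i => .var (.inr (k i))) else ⊥) ⊔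
      (if ∃ y : Fin l → B, (∀ i, c (k i) = some (y i)) ∧ Structure.RelMap R y then ⊤ else ⊥),
      fun D _ _ v w xs => ?_⟩
    rw [BoundedFormula.realize_sup]
    refine or_congr ?_ ?_
    · split_ifs with h
      · simp only [BoundedFormula.Realize, Term.realize_var, Sum.elim_inr, h, pick]
        constructor
        · intro hr
          exact ⟨_, rfl, hr⟩
        · rintro ⟨y, hy, hr⟩
          have : y = fun i => xs (k i) := by
            funext i
            exact (Sum.inl_injective (congrFun hy i)).symm
          rwa [this] at hr
      · simp only [BoundedFormula.realize_bot, false_iff]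
        rintro ⟨y, hy, -⟩
        apply h
        intro i
        have := congrFun hy i
        rcases hc : c (k i) with _ | b
        · rfl
        · simp [pick, hc] at this
    · have key : ∀ y : Fin l → B,
          ((fun i => @Term.realize L (D ⊕ B) (sumStr L D B) _
            (Sum.elim w (fun k => pick (c k) (xs k))) (Term.var (Sum.inr (k i)) : L.Term _))
            = Sum.inr ∘ y) ↔ ∀ i, c (k i) = some (y i) := by
        intro y
        rw [funext_iff]
        refine forall_congr' fun i => ?_
        rcases hc : c (k i) with _ | b <;> simp [pick, hc]
      simp only [key]
      split_ifs with h
      · simpa using h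
      · simpa using h
  | imp φ₁ φ₂ ih₁ ih₂ =>
    intro c
    obtain ⟨ψ₁, h₁⟩ := ih₁ c
    obtain ⟨ψ₂, h₂⟩ := ih₂ c
    exact ⟨ψ₁.imp ψ₂, fun D _ _ v w xs => imp_congr (h₁ D v w xs) (h₂ D v w xs)⟩
  | @all n φ ih =>
    intro c
    choose ψ hψ using fun o : Option B => ih (Fin.snoc c o)
    have key : ∀ (D : Type) (o : Option B) (xs : Fin n → D) (d : D),
        (fun j => pick ((Fin.snoc c o : Fin (n+1) → Option B) j)
          ((Fin.snoc xs d : Fin (n+1) → D) j))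
        = (Fin.snoc (fun j => pick (c j) (xs j)) (pick o d) : Fin (n+1) → D ⊕ B) := by
      intro D o xs d
      funext j
      refine Fin.lastCases ?_ (fun j => ?_) j <;> simp
    refine ⟨(BoundedFormula.iInf ψ).all, fun D _ _ v w xs => ?_⟩
    rw [BoundedFormula.realize_all]
    simp only [BoundedFormula.realize_iInf]
    letI := sumStr L D B
    rw [BoundedFormula.realize_all]
    constructor
    · rintro h (d | b)
      · have := (hψ none D v w _).1 (h d none)
        rw [key] at this
        exact this
      · have := (hψ (some b) D v w _).1 (h (Classical.arbitrary D) (some b))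
        rw [key] at this
        exact this
    · intro h d o
      refine (hψ o D v w _).2 ?_
      rw [key]
      exact h _

end CoCSPAux

/-- Let `L` be a finite relational language and `F = {F i}` a finite set
of finite nonempty `L`-structures that are pairwise homomorphically incomparable.  If
`coCSP(F)` is FO-definable, then `coCSP(F i)` is FO-definable for every `i`. -/
theorem forall_FODefinable_of_coCSP_FODefinable
    (L : Language) [L.IsRelational] [Finite L.Symbols]
    (ι : Type) [Finite ι] (F : ι → Type)
    [∀ i, Finite (F i)] [∀ i, Nonempty (F i)] [∀ i, L.Structure (F i)]
    (hinc : ∀ i j, i ≠ j → IsEmpty (F i →[L] F j))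
    (h : ∃ φ : L.Sentence,
      ∀ (D : Type) [Finite D] [Nonempty D] [L.Structure D],
        D ⊨ φ ↔ ∀ i, IsEmpty (D →[L] F i)) :
    ∀ i, ∃ φ : L.Sentence,
      ∀ (D : Type) [Finite D] [Nonempty D] [L.Structure D],
        D ⊨ φ ↔ IsEmpty (D →[L] F i) := by
  intro i
  obtain ⟨φ, hφ⟩ := h
  obtain ⟨ψ, hψ⟩ := CoCSPAux.translate L (F i) φ Fin.elim0
  refine ⟨ψ, fun D _ _ _ => ?_⟩
  letI := CoCSPAux.sumStr L D (F i)
  have h1 : D ⊨ ψ ↔ (D ⊕ F i) ⊨ φ := by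
    refine (hψ D default default default).trans ?_
    unfold Language.Sentence.Realize Language.Formula.Realize
    exact iff_of_eq (congrArg _ (Subsingleton.elim _ _))
  rw [h1, hφ]
  constructor
  · intro hE
    refine ⟨fun f => (hE i).false ?_⟩
    refine ⟨Sum.elim f id, fun g => isEmptyElim g, ?_⟩
    rintro n R x (⟨y, rfl, hr⟩ | ⟨y, rfl, hr⟩)
    · exact f.map_rel R y hr
    · exact hr
  · intro hE j
    refine ⟨fun f => ?_⟩
    by_cases hij : i = j
    · subst hij
      exact hE.false ⟨fun d => f (Sum.inl d), fun g => isEmptyElim g,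
        fun R x hr => f.map_rel R (Sum.inl ∘ x) (Or.inl ⟨x, rfl, hr⟩)⟩
    · exact (hinc i j hij).false ⟨fun d => f (Sum.inr d), fun g => isEmptyElim g,
        fun R x hr => f.map_rel R (Sum.inr ∘ x) (Or.inr ⟨x, rfl, hr⟩)⟩
end

section
/- Let L be a finite relational language, n ≥ 1, let L_c be L extended with constant symbols c₁,…,c_n, and let L_P be L extended with n fresh unary relation symbols P₁,…,P_n. For every finite set F of finite nonempty L_c-structures, the following are equivalent: (1) coCSP(F) is FO-definable, i.e., there is an L_c-sentence φ such that a finite nonempty L_c-structure D satisfies φ if and only if D has no L_c-homomorphism to any member of F; (2) coCSP(F^c) is FO-definable, i.e., there is an L_P-sentence ψ such that a finite nonempty L_P-structure D satisfies ψ if and only if D has no L_P-homomorphism to any member of F^c, where F^c = {B^c : B ∈ F}. -/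
open FirstOrder

/-- The relational language with `n` unary relation symbols `P₁, …, Pₙ`. -/
def unaryLang (n : ℕ) : Language where
  Functions := fun _ => Empty
  Relations := fun l => match l with
    | 1 => Fin n
    | _ => Empty

/-- The structure for `unaryLang n` on `β` in which `Pᵢ` is interpreted by `P i`. -/
def unaryStructure {n : ℕ} {β : Type*} (P : Fin n → β → Prop) : (unaryLang n).Structure β where
  funMap := fun {_} f _ => f.elim
  RelMap := fun {l} r x =>
    match l, r, x with
    | 1, i, x => P i (x 0)

/-- Given an `L[[Fin n]]`-structure `B`, the structure `B^c` over the language `L_P`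
(`L` extended with `n` fresh unary relation symbols `P₁, …, Pₙ`): the symbols of `L`
are interpreted as in `B`, and `Pᵢ` is interpreted as the singleton `{cᵢ^B}`. -/
def ccStruct (L : Language) (n : ℕ) (β : Type*) [(L[[Fin n]]).Structure β] :
    (L.sum (unaryLang n)).Structure β :=
  letI : L.Structure β := (L.lhomWithConstants (Fin n)).reduct β
  letI : (unaryLang n).Structure β :=
    unaryStructure (fun i b =>
      b = Language.Structure.funMap (L := L[[Fin n]]) (M := β) (L.con i) Fin.elim0)
  Language.sumStructure L (unaryLang n) β

namespace ElimConst

open FirstOrder.Language FirstOrder.Language.Structure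

universe u v

/-- Uniform first-order definability of a predicate on tuples of structures. -/
def FOd (L' : FirstOrder.Language.{u, v}) (α : Type)
    (Q : (D : Type) → L'.Structure D → (α → D) → Prop) : Prop :=
  ∃ ψ : L'.Formula α, ∀ (D : Type) (S : L'.Structure D) (x : α → D),
    ψ.Realize x ↔ Q D S x

section closure

variable {L' : FirstOrder.Language.{u, v}} {α : Type} {Q Q' : (D : Type) → L'.Structure D → (α → D) → Prop}

theorem FOd.congr (h : FOd L' α Q) (e : ∀ D S x, Q D S x ↔ Q' D S x) : FOd L' α Q' := by
  obtain ⟨ψ, hψ⟩ := h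
  exact ⟨ψ, fun D S x => (hψ D S x).trans (e D S x)⟩

theorem FOd.const (p : Prop) : FOd L' α (fun _ _ _ => p) := by
  by_cases hp : p
  · exact ⟨⊤, fun D S x => by simp [hp]⟩
  · exact ⟨⊥, fun D S x => by simp [hp]⟩

theorem FOd.imp (h : FOd L' α Q) (h' : FOd L' α Q') :
    FOd L' α (fun D S x => Q D S x → Q' D S x) := by
  obtain ⟨ψ, hψ⟩ := h
  obtain ⟨ψ', hψ'⟩ := h'
  exact ⟨ψ.imp ψ', fun D S x => by rw [Formula.realize_imp, hψ, hψ']⟩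

theorem FOd.and (h : FOd L' α Q) (h' : FOd L' α Q') :
    FOd L' α (fun D S x => Q D S x ∧ Q' D S x) := by
  obtain ⟨ψ, hψ⟩ := h
  obtain ⟨ψ', hψ'⟩ := h'
  exact ⟨ψ ⊓ ψ', fun D S x => by rw [Formula.realize_inf, hψ, hψ']⟩

theorem FOd.or (h : FOd L' α Q) (h' : FOd L' α Q') :
    FOd L' α (fun D S x => Q D S x ∨ Q' D S x) := by
  obtain ⟨ψ, hψ⟩ := h
  obtain ⟨ψ', hψ'⟩ := h'
  exact ⟨ψ ⊔ ψ', fun D S x => by rw [Formula.realize_sup, hψ, hψ']⟩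

theorem FOd.iff (h : FOd L' α Q) (h' : FOd L' α Q') :
    FOd L' α (fun D S x => (Q D S x ↔ Q' D S x)) :=
  ((h.imp h').and (h'.imp h)).congr fun _ _ _ => iff_def.symm

theorem FOd.fall {κ : Type} [Finite κ] {q : κ → (D : Type) → L'.Structure D → (α → D) → Prop}
    (h : ∀ k, FOd L' α (q k)) : FOd L' α (fun D S x => ∀ k, q k D S x) := by
  choose ψ hψ using h
  exact ⟨Formula.iInf ψ, fun D S x => by simp [Formula.realize_iInf, hψ]⟩

theorem FOd.fex {κ : Type} [Finite κ] {q : κ → (D : Type) → L'.Structure D → (α → D) → Prop}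
    (h : ∀ k, FOd L' α (q k)) : FOd L' α (fun D S x => ∃ k, q k D S x) := by
  choose ψ hψ using h
  exact ⟨Formula.iSup ψ, fun D S x => by simp [Formula.realize_iSup, hψ]⟩

/-- A predicate depending only on finitely many definable predicates is definable. -/
theorem FOd.depends {κ : Type} [Finite κ] {q : κ → (D : Type) → L'.Structure D → (α → D) → Prop}
    (h : ∀ k, FOd L' α (q k)) (G : (κ → Prop) → Prop) :
    FOd L' α (fun D S x => G (fun k => q k D S x)) := by
  have : FOd L' α (fun D S x => ∃ e : κ → Prop, G e ∧ ∀ k, (e k ↔ q k D S x)) :=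
    FOd.fex fun e => (FOd.const (G e)).and (FOd.fall fun k => (FOd.const (e k)).iff (h k))
  refine this.congr fun D S x => ⟨?_, fun hG => ⟨_, hG, fun _ => Iff.rfl⟩⟩
  rintro ⟨e, he, hk⟩
  have : e = fun k => q k D S x := funext fun k => propext (hk k)
  exact this ▸ he

theorem FOd.exs {β : Type} [Finite β] {q : (D : Type) → L'.Structure D → (α ⊕ β → D) → Prop}
    (h : FOd L' (α ⊕ β) q) : FOd L' α (fun D S x => ∃ z : β → D, q D S (Sum.elim x z)) := by
  obtain ⟨ψ, hψ⟩ := h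
  exact ⟨ψ.iExs β, fun D S x => by simp [Formula.realize_iExs, hψ]⟩

theorem FOd.alls {β : Type} [Finite β] {q : (D : Type) → L'.Structure D → (α ⊕ β → D) → Prop}
    (h : FOd L' (α ⊕ β) q) : FOd L' α (fun D S x => ∀ z : β → D, q D S (Sum.elim x z)) := by
  obtain ⟨ψ, hψ⟩ := h
  exact ⟨ψ.iAlls β, fun D S x => by simp [Formula.realize_iAlls, hψ]⟩

theorem FOd.eqTerm (s t : L'.Term α) :
    FOd L' α (fun _ _ x => s.realize x = t.realize x) :=
  ⟨s.equal t, fun _ _ _ => Formula.realize_equal⟩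

theorem FOd.relTerm {l : ℕ} (R : L'.Relations l) (t : Fin l → L'.Term α) :
    FOd L' α (fun _ _ x => RelMap R (fun j => (t j).realize x)) :=
  ⟨R.formula t, fun _ _ _ => Formula.realize_rel⟩

end closure

variable (L : FirstOrder.Language.{u, v}) (n : ℕ)

/-- The symbol `P i`. -/
def PSym (i : Fin n) : (L.sum (unaryLang n)).Relations 1 := Sum.inr i

/-- `P i` holds of `d`. -/
def PP {D : Type} (S : (L.sum (unaryLang n)).Structure D) (i : Fin n) (d : D) : Prop :=
  RelMap (PSym L n i) (fun _ => d)

/-- `P i` extended to `D` plus new points. -/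
def QQ {D : Type} (S : (L.sum (unaryLang n)).Structure D) (i : Fin n) : D ⊕ Fin n → Prop
  | Sum.inl d => PP L n S i d
  | Sum.inr j => i = j

/-- Overlap of `P i` and `P j`. -/
def EE {D : Type} (S : (L.sum (unaryLang n)).Structure D) (i j : Fin n) : Prop :=
  ∃ d, PP L n S i d ∧ PP L n S j d

/-- The identification relation. -/
def rr {D : Type} (S : (L.sum (unaryLang n)).Structure D) (a b : D ⊕ Fin n) : Prop :=
  a = b ∨ ∃ i j, QQ L n S i a ∧ QQ L n S j b ∧ Relation.EqvGen (EE L n S) i j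

/-- The identification setoid. -/
def st {D : Type} (S : (L.sum (unaryLang n)).Structure D) : Setoid (D ⊕ Fin n) where
  r := rr L n S
  iseqv := by
    refine ⟨fun a => Or.inl rfl, ?_, ?_⟩
    · rintro a b (rfl | ⟨i, j, h1, h2, h3⟩)
      · exact Or.inl rfl
      · exact Or.inr ⟨j, i, h2, h1, h3.symm⟩
    · rintro a b c (rfl | ⟨i, j, h1, h2, h3⟩) h
      · exact h
      · rcases h with (rfl | ⟨i', j', h1', h2', h3'⟩)
        · exact Or.inr ⟨i, j, h1, h2, h3⟩
        · refine Or.inr ⟨i, j', h1, h2', h3.trans _ _ _ (Relation.EqvGen.trans _ _ _ ?_ h3')⟩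
          cases b with
          | inl d => exact Relation.EqvGen.rel _ _ ⟨d, h2, h1'⟩
          | inr k =>
            have e1 : j = k := h2
            have e2 : i' = k := h1'
            rw [e1, e2]; exact Relation.EqvGen.refl _

/-- The quotient domain. -/
def Star {D : Type} (S : (L.sum (unaryLang n)).Structure D) : Type := Quotient (st L n S)

/-- The quotient map. -/
def mk {D : Type} (S : (L.sum (unaryLang n)).Structure D) (a : D ⊕ Fin n) : Star L n S :=
  Quotient.mk (st L n S) a

theorem mk_eq {D : Type} (S : (L.sum (unaryLang n)).Structure D) (a b : D ⊕ Fin n) :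
    mk L n S a = mk L n S b ↔ rr L n S a b := Quotient.eq (r := st L n S)

theorem mk_surj {D : Type} (S : (L.sum (unaryLang n)).Structure D) (x : Star L n S) :
    ∃ a, mk L n S a = x := Quotient.exists_rep x

variable [L.IsRelational]

/-- Relational part of the quotient structure. -/
def starL {D : Type} (S : (L.sum (unaryLang n)).Structure D) : L.Structure (Star L n S) where
  funMap := fun f _ => isEmptyElim f
  RelMap := fun {l} R x => ∃ z : Fin l → D, (∀ j, mk L n S (Sum.inl (z j)) = x j) ∧
    RelMap (L := L.sum (unaryLang n)) (Sum.inl R) z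

/-- The quotient structure. -/
def starC {D : Type} (S : (L.sum (unaryLang n)).Structure D) :
    (L[[Fin n]]).Structure (Star L n S) :=
  letI := starL L n S
  letI := constantsOn.structure (fun i : Fin n => mk L n S (Sum.inr i))
  Language.sumStructure L (constantsOn (Fin n)) (Star L n S)

theorem FOd_PP {α : Type} (i : Fin n) (a : α) :
    FOd (L.sum (unaryLang n)) α (fun _ S x => PP L n S i (x a)) :=
  FOd.relTerm (PSym L n i) (fun _ => Term.var a)

theorem FOd_QQ {α : Type} (i : Fin n) (s : α ⊕ Fin n) :
    FOd (L.sum (unaryLang n)) α (fun _ S x => QQ L n S i (Sum.map x id s)) := by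
  cases s with
  | inl a => exact FOd_PP L n i a
  | inr j => exact FOd.const (i = j)

theorem FOd_EE {α : Type} (i j : Fin n) :
    FOd (L.sum (unaryLang n)) α (fun _ S _ => EE L n S i j) := by
  have := ((FOd_PP L n i (Sum.inr () : α ⊕ Unit)).and (FOd_PP L n j (Sum.inr ()))).exs
  refine this.congr fun D S x => ?_
  constructor
  · rintro ⟨z, hz⟩; exact ⟨z (), hz⟩
  · rintro ⟨d, hd⟩; exact ⟨fun _ => d, hd⟩

theorem FOd_eqv {α : Type} (i j : Fin n) :
    FOd (L.sum (unaryLang n)) α (fun _ S _ => Relation.EqvGen (EE L n S) i j) :=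
  FOd.depends (κ := Fin n × Fin n) (q := fun k _ S _ => EE L n S k.1 k.2)
    (fun k => FOd_EE L n k.1 k.2)
    (fun e => Relation.EqvGen (fun a b => e (a, b)) i j)

theorem FOd_mkeq {α : Type} (s t : α ⊕ Fin n) :
    FOd (L.sum (unaryLang n)) α
      (fun _ S x => mk L n S (Sum.map x id s) = mk L n S (Sum.map x id t)) := by
  have h1 : FOd (L.sum (unaryLang n)) α (fun D S x => Sum.map x id s = Sum.map x id t) := by
    cases s with
    | inl a =>
      cases t with
      | inl b => exact (FOd.eqTerm (Term.var a) (Term.var b)).congr fun D S x => by simp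
      | inr j => exact (FOd.const False).congr fun D S x => by simp
    | inr i =>
      cases t with
      | inl b => exact (FOd.const False).congr fun D S x => by simp
      | inr j => exact (FOd.const (i = j)).congr fun D S x => by simp
  have h2 : FOd (L.sum (unaryLang n)) α (fun D S x => ∃ i j, QQ L n S i (Sum.map x id s) ∧
      QQ L n S j (Sum.map x id t) ∧ Relation.EqvGen (EE L n S) i j) :=
    FOd.fex fun i => FOd.fex fun j => (FOd_QQ L n i s).and ((FOd_QQ L n j t).and (FOd_eqv L n i j))
  exact (h1.or h2).congr fun D S x => (mk_eq L n S _ _).symm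

/-- Assignment in the quotient. -/
def asg {α : Type} {k : ℕ} (σ : Fin k → α ⊕ Fin n) {D : Type}
    (S : (L.sum (unaryLang n)).Structure D) (x : α → D) : Fin k → Star L n S :=
  fun j => mk L n S (Sum.map x id (σ j))

theorem term_star {α : Type} {k : ℕ} (σ : Fin k → α ⊕ Fin n)
    (t : (L[[Fin n]]).Term (Empty ⊕ Fin k)) :
    ∃ s : α ⊕ Fin n, ∀ (D : Type) (S : (L.sum (unaryLang n)).Structure D) (x : α → D),
      @Term.realize _ _ (starC L n S) _ (Sum.elim default (asg L n σ S x)) t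
        = mk L n S (Sum.map x id s) := by
  cases t with
  | var y =>
    rcases y with y | j
    · exact y.elim
    · exact ⟨σ j, fun D S x => rfl⟩
  | @func l f ts =>
    rcases f with f | c
    · exact isEmptyElim f
    · cases l with
      | zero => exact ⟨Sum.inr c, fun D S x => rfl⟩
      | succ l => exact isEmptyElim (show PEmpty from c)

theorem FOd_star {k : ℕ} (φ : (L[[Fin n]]).BoundedFormula Empty k) :
    ∀ {α : Type} (σ : Fin k → α ⊕ Fin n), FOd (L.sum (unaryLang n)) α
      (fun _ S x => @BoundedFormula.Realize _ _ (starC L n S) _ _ φ default (asg L n σ S x)) := by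
  induction φ with
  | falsum => intro α σ; exact FOd.const False
  | equal t₁ t₂ =>
    intro α σ
    obtain ⟨s₁, h₁⟩ := term_star L n σ t₁
    obtain ⟨s₂, h₂⟩ := term_star L n σ t₂
    refine (FOd_mkeq L n s₁ s₂).congr fun D S x => ?_
    rw [← h₁, ← h₂]; rfl
  | @rel k l R ts =>
    intro α σ
    rcases R with R | R
    · choose s hs using fun j => term_star L n σ (ts j)
      have h1 : FOd (L.sum (unaryLang n)) (α ⊕ Fin l) (fun D S y =>
          (∀ j, mk L n S (Sum.map y id (Sum.inl (Sum.inr j)))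
            = mk L n S (Sum.map y id (Sum.map Sum.inl id (s j)))) ∧
          RelMap (L := L.sum (unaryLang n)) (Sum.inl R)
            (fun j => (Term.var (Sum.inr j) : (L.sum (unaryLang n)).Term (α ⊕ Fin l)).realize y)) :=
        (FOd.fall fun j => FOd_mkeq L n _ _).and (FOd.relTerm _ _)
      refine h1.exs.congr fun D S x => ?_
      refine exists_congr fun z => and_congr (forall_congr' fun j => ?_) Iff.rfl
      beta_reduce
      rw [hs]
      have : Sum.map (Sum.elim x z) id (Sum.map Sum.inl id (s j)) = Sum.map x id (s j) := by
        cases s j <;> rfl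
      rw [this]; rfl
    · exact isEmptyElim (show Empty from R)
  | imp _ _ ih1 ih2 => intro α σ; exact (ih1 σ).imp (ih2 σ)
  | @all k φ ih =>
    intro α σ
    have h1 := (ih (α := α ⊕ Unit)
      (Fin.snoc (fun j => Sum.map Sum.inl id (σ j)) (Sum.inl (Sum.inr ())))).alls
    have h2 := FOd.fall fun i : Fin n => ih (α := α) (Fin.snoc σ (Sum.inr i))
    refine (h1.and h2).congr fun D S x => ?_
    have e1 : ∀ z : Unit → D, asg L n (Fin.snoc (fun j => Sum.map Sum.inl id (σ j))
        (Sum.inl (Sum.inr ())) : Fin (k+1) → (α ⊕ Unit) ⊕ Fin n) S (Sum.elim x z)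
        = Fin.snoc (asg L n σ S x) (mk L n S (Sum.inl (z ()))) := by
      intro z
      funext j
      refine Fin.lastCases ?_ (fun j => ?_) j
      · simp [asg]
      · simp only [asg, Fin.snoc_castSucc]
        cases σ j <;> rfl
    have e2 : ∀ i : Fin n, asg L n (Fin.snoc σ (Sum.inr i) : Fin (k+1) → α ⊕ Fin n) S x
        = Fin.snoc (asg L n σ S x) (mk L n S (Sum.inr i)) := by
      intro i
      funext j
      refine Fin.lastCases ?_ (fun j => ?_) j
      · simp [asg]
      · simp [asg]
    simp only [e1, e2]
    constructor
    · rintro ⟨ha, hb⟩ y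
      obtain ⟨a, rfl⟩ := mk_surj L n S y
      cases a with
      | inl d => exact ha (fun _ => d)
      | inr i => exact hb i
    · intro h
      exact ⟨fun z => h _, fun i => h _⟩

/-- Interpretation of the constant. -/
def cc {B : Type} (T : (L[[Fin n]]).Structure B) (i : Fin n) : B :=
  funMap (L := L[[Fin n]]) (M := B) (L.con i) Fin.elim0

theorem hom_star {D : Type} (S : (L.sum (unaryLang n)).Structure D) {B : Type}
    (T : (L[[Fin n]]).Structure B) :
    Nonempty (@Language.Hom (L[[Fin n]]) (Star L n S) B (starC L n S) T) ↔
    Nonempty (@Language.Hom (L.sum (unaryLang n)) D B S (ccStruct L n B)) := by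
  constructor
  · letI := starC L n S
    rintro ⟨g⟩
    refine ⟨@Language.Hom.mk _ _ _ S (ccStruct L n B)
      (fun d => g.toFun (mk L n S (Sum.inl d))) ?_ ?_⟩
    · intro l f x
      rcases f with f | f
      · exact isEmptyElim f
      · exact isEmptyElim (show Empty from f)
    · intro l R x hR
      rcases R with R | R
      · exact g.map_rel' (Sum.inl R : (L[[Fin n]]).Relations l)
          (fun j => mk L n S (Sum.inl (x j))) ⟨x, fun _ => rfl, hR⟩
      · match l, R, x, hR with
        | 1, i, x, hR =>
          have h1 : mk L n S (Sum.inl (x 0)) = mk L n S (Sum.inr i) := by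
            rw [mk_eq]
            refine Or.inr ⟨i, i, ?_, rfl, Relation.EqvGen.refl _⟩
            have : x = fun _ => x 0 := funext fun j => by rw [Subsingleton.elim j 0]
            rw [this] at hR
            exact hR
          show g.toFun (mk L n S (Sum.inl (x 0))) = cc L n T i
          rw [h1]
          refine (g.map_fun' (L.con i) Fin.elim0).trans ?_
          exact congrArg _ (funext fun j => j.elim0)
  · rintro ⟨h⟩
    letI := ccStruct L n B
    let h' : D ⊕ Fin n → B := Sum.elim h.toFun (cc L n T)
    have hQ : ∀ i a, QQ L n S i a → h' a = cc L n T i := by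
      intro i a ha
      cases a with
      | inl d => exact h.map_rel' (PSym L n i) (fun _ => d) ha
      | inr j => exact congrArg (cc L n T) (Eq.symm ha)
    have hE : ∀ i j, Relation.EqvGen (EE L n S) i j → cc L n T i = cc L n T j := by
      intro i j hij
      induction hij with
      | rel i j hij =>
        obtain ⟨d, h1, h2⟩ := hij
        exact (hQ i (Sum.inl d) h1).symm.trans (hQ j (Sum.inl d) h2)
      | refl => rfl
      | symm _ _ _ ih => exact ih.symm
      | trans _ _ _ _ _ ih1 ih2 => exact ih1.trans ih2
    have hr : ∀ a b, rr L n S a b → h' a = h' b := by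
      rintro a b (rfl | ⟨i, j, h1, h2, h3⟩)
      · rfl
      · rw [hQ i a h1, hQ j b h2, hE i j h3]
    let g : Star L n S → B := Quotient.lift (s := st L n S) h' hr
    refine ⟨@Language.Hom.mk _ _ _ (starC L n S) T g ?_ ?_⟩
    · intro l f x
      rcases f with f | c
      · exact isEmptyElim f
      · cases l with
        | zero =>
          show cc L n T c = _
          exact congrArg _ (funext fun j => j.elim0)
        | succ l => exact isEmptyElim (show PEmpty from c)
    · intro l R x hR
      rcases R with R | R
      · obtain ⟨z, hz, hR⟩ := hR
        have : g ∘ x = h.toFun ∘ z := by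
          funext j
          simp only [Function.comp, ← hz j]
          rfl
        rw [this]
        exact h.map_rel' (Sum.inl R : (L.sum (unaryLang n)).Relations l) z hR
      · exact isEmptyElim (show Empty from R)

theorem hom_cc {D : Type} (S : (L[[Fin n]]).Structure D) {B : Type}
    (T : (L[[Fin n]]).Structure B) :
    Nonempty (@Language.Hom (L[[Fin n]]) D B S T) ↔
    Nonempty (@Language.Hom (L.sum (unaryLang n)) D B (ccStruct L n D) (ccStruct L n B)) := by
  constructor
  · rintro ⟨g⟩
    refine ⟨@Language.Hom.mk _ _ _ (ccStruct L n D) (ccStruct L n B) g.toFun ?_ ?_⟩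
    · intro l f x
      rcases f with f | f
      · exact isEmptyElim f
      · exact isEmptyElim (show Empty from f)
    · intro l R x hR
      rcases R with R | R
      · exact g.map_rel' (Sum.inl R : (L[[Fin n]]).Relations l) x hR
      · match l, R, x, hR with
        | 1, i, x, hR =>
          have h1 : x 0 = cc L n S i := hR
          show g.toFun (x 0) = cc L n T i
          rw [h1]
          refine (g.map_fun' (L.con i) Fin.elim0).trans ?_
          exact congrArg _ (funext fun j => j.elim0)
  · rintro ⟨h⟩
    letI i1 := ccStruct L n B
    letI i2 := ccStruct L n D
    refine ⟨@Language.Hom.mk _ _ _ S T h.toFun ?_ ?_⟩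
    · intro l f x
      rcases f with f | c
      · exact isEmptyElim f
      · cases l with
        | zero =>
          have h1 : h.toFun (cc L n S c) = cc L n T c :=
            h.map_rel' (PSym L n c) (fun _ => cc L n S c) rfl
          have e1 : x = Fin.elim0 := funext fun j => j.elim0
          have e2 : h.toFun ∘ x = Fin.elim0 := funext fun j => j.elim0
          rw [e2, e1]
          exact h1
        | succ l => exact isEmptyElim (show PEmpty from c)
    · intro l R x hR
      rcases R with R | R
      · exact h.map_rel' (Sum.inl R : (L.sum (unaryLang n)).Relations l) x hR
      · exact isEmptyElim (show Empty from R)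

theorem term_cc {α : Type} {k : ℕ} (σ : Fin k → α)
    (t : (L.sum (unaryLang n)).Term (Empty ⊕ Fin k)) :
    ∃ s : α, ∀ (D : Type) (S : (L[[Fin n]]).Structure D) (x : α → D),
      @Term.realize _ _ (ccStruct L n D) _ (Sum.elim default (x ∘ σ)) t = x s := by
  cases t with
  | var y =>
    rcases y with y | j
    · exact y.elim
    · exact ⟨σ j, fun D S x => rfl⟩
  | @func l f ts =>
    rcases f with f | c
    · exact isEmptyElim f
    · exact isEmptyElim (show Empty from c)

theorem FOd_cc {k : ℕ} (φ : (L.sum (unaryLang n)).BoundedFormula Empty k) :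
    ∀ {α : Type} (σ : Fin k → α), FOd (L[[Fin n]]) α
      (fun D _ x => @BoundedFormula.Realize _ _ (ccStruct L n D) _ _ φ default (x ∘ σ)) := by
  induction φ with
  | falsum => intro α σ; exact FOd.const False
  | equal t₁ t₂ =>
    intro α σ
    obtain ⟨s₁, h₁⟩ := term_cc L n σ t₁
    obtain ⟨s₂, h₂⟩ := term_cc L n σ t₂
    refine (FOd.eqTerm (Term.var s₁) (Term.var s₂)).congr fun D S x => ?_
    show x s₁ = x s₂ ↔ _
    rw [← h₁ D S x, ← h₂ D S x]; rfl
  | @rel k l R ts =>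
    intro α σ
    choose s hs using fun j => term_cc L n σ (ts j)
    rcases R with R | R
    · refine (FOd.relTerm (L' := L[[Fin n]]) (Sum.inl R) (fun j => Term.var (s j))).congr
        fun D S x => ?_
      show _ ↔ @RelMap _ _ (ccStruct L n D) _ _ (fun j => _)
      simp only [hs]
      rfl
    · match l, R, ts, s, hs with
      | 1, i, ts, s, hs =>
        refine (FOd.eqTerm (L' := L[[Fin n]]) (Term.var (s 0))
          (Term.func (L.con i) Fin.elim0)).congr fun D S x => ?_
        show _ ↔ @RelMap _ _ (ccStruct L n D) _ _ (fun j => _)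
        simp only [hs]
        show x (s 0) = _ ↔ x (s 0) = _
        have : (fun j : Fin 0 => Term.realize x (Fin.elim0 j : (L[[Fin n]]).Term α))
          = (Fin.elim0 : Fin 0 → D) := funext fun j => j.elim0
        rw [Term.realize_func, this]
  | imp _ _ ih1 ih2 => intro α σ; exact (ih1 σ).imp (ih2 σ)
  | @all k φ ih =>
    intro α σ
    have h1 := (ih (α := α ⊕ Unit) (Fin.snoc (fun j => Sum.inl (σ j)) (Sum.inr ()))).alls
    refine h1.congr fun D S x => ?_
    have e1 : ∀ z : Unit → D, (Sum.elim x z) ∘ (Fin.snoc (fun j => Sum.inl (σ j))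
        (Sum.inr ()) : Fin (k+1) → α ⊕ Unit) = Fin.snoc (x ∘ σ) (z ()) := by
      intro z
      funext j
      refine Fin.lastCases ?_ (fun j => ?_) j
      · simp
      · simp
    simp only [e1]
    exact ⟨fun h d => h (fun _ => d), fun h z => h _⟩

end ElimConst

/-- Let `L` be a finite relational language, `n ≥ 1`, `L_c = L[[Fin n]]`
the extension of `L` by constants `c₁, …, cₙ`, and `L_P` the extension of `L` by `n` fresh
unary relation symbols.  For a finite set `F = {F i}` of finite nonempty `L_c`-structures,
`coCSP(F)` is FO-definable (by an `L_c`-sentence over finite nonempty `L_c`-structures)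
iff `coCSP(F^c)` is FO-definable (by an `L_P`-sentence over finite nonempty
`L_P`-structures), where `F^c = {(F i)^c}`. -/
theorem coCSP_FODefinable_iff_eliminating_constants
    (L : Language) [L.IsRelational] [Finite L.Symbols] (n : ℕ) (hn : 1 ≤ n)
    (ι : Type) [Finite ι] (F : ι → Type)
    [∀ i, Finite (F i)] [∀ i, Nonempty (F i)] [∀ i, (L[[Fin n]]).Structure (F i)] :
    (∃ φ : (L[[Fin n]]).Sentence,
      ∀ (D : Type) [Finite D] [Nonempty D] [(L[[Fin n]]).Structure D],
        D ⊨ φ ↔ ∀ i, IsEmpty (Language.Hom (L[[Fin n]]) D (F i))) ↔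
    (∃ ψ : (L.sum (unaryLang n)).Sentence,
      ∀ (D : Type) [Finite D] [Nonempty D] [(L.sum (unaryLang n)).Structure D],
        D ⊨ ψ ↔ ∀ i,
          IsEmpty (@Language.Hom (L.sum (unaryLang n)) D (F i) _ (ccStruct L n (F i)))) := by
  constructor
  · rintro ⟨φ, hφ⟩
    obtain ⟨ψ, hψ⟩ := ElimConst.FOd_star L n φ (α := Empty) Fin.elim0
    refine ⟨ψ, fun D _ _ S => ?_⟩
    letI := ElimConst.starC L n S
    haveI : Finite (ElimConst.Star L n S) :=
      inferInstanceAs (Finite (Quotient (ElimConst.st L n S)))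
    haveI : Nonempty (ElimConst.Star L n S) := ‹Nonempty D›.map fun d => ElimConst.mk L n S (Sum.inl d)
    have h1 := hφ (ElimConst.Star L n S)
    have h2 := hψ D S default
    have e : ElimConst.asg L n (Fin.elim0 : Fin 0 → Empty ⊕ Fin n) S default = default :=
      Subsingleton.elim _ _
    beta_reduce at h2
    rw [e] at h2
    refine (h2.trans h1).trans (forall_congr' fun i => ?_)
    rw [← not_nonempty_iff, ← not_nonempty_iff]
    exact not_congr (ElimConst.hom_star L n S _)
  · rintro ⟨ψ, hψ⟩
    obtain ⟨φ, hφ⟩ := ElimConst.FOd_cc L n ψ (α := Empty) Fin.elim0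
    refine ⟨φ, fun D _ _ S => ?_⟩
    have h1 := @hψ D _ _ (ccStruct L n D)
    have h2 := hφ D S default
    have e : (default : Empty → D) ∘ (Fin.elim0 : Fin 0 → Empty) = default :=
      Subsingleton.elim _ _
    beta_reduce at h2
    rw [e] at h2
    refine (h2.trans h1).trans (forall_congr' fun i => ?_)
    rw [← not_nonempty_iff, ← not_nonempty_iff]
    exact not_congr (ElimConst.hom_cc L n S _).symm
end

section
/- Let L be a finite relational language, n ≥ 1, L_c be L extended with constant symbols c₁,…,c_n, and L_P be L extended with n fresh unary relation symbols P₁,…,P_n. Let B₁,…,B_m be finite nonempty L_c-structures that are pairwise homomorphically incomparable. Then coCSP({B₁,…,B_m}) is FO-definable (i.e., some L_c-sentence holds in a finite nonempty L_c-structure D exactly when D has no L_c-homomorphism to any Bᵢ) if and only if, for each 1 ≤ i ≤ m, coCSP(Bᵢ^c) is FO-definable (i.e., some L_P-sentence holds in a finite nonempty L_P-structure D exactly when D has no L_P-homomorphism to Bᵢ^c). -/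
open FirstOrder

section Helpers

open FirstOrder.Language

variable {L : Language} [L.IsRelational] {n : ℕ}

/-- Interpretation of the `i`-th constant. -/
abbrev cstOf (L : Language) {n : ℕ} (B : Type*) [(L[[Fin n]]).Structure B] (i : Fin n) : B :=
  Structure.funMap (L := L[[Fin n]]) (M := B) (L.con i) Fin.elim0

/-- The `i`-th unary symbol as a relation symbol of the sum language. -/
abbrev unSym (L : Language) {n : ℕ} (i : Fin n) : (L.sum (unaryLang n)).Relations 1 :=
  Sum.inr (show (unaryLang n).Relations 1 from i)

lemma arity_zero {r : ℕ} (f : (L[[Fin n]]).Functions r) : r = 0 := by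
  cases r with
  | zero => rfl
  | succ r =>
    rcases f with f | f
    · exact isEmptyElim f
    · exact isEmptyElim (α := (constantsOn (Fin n)).Functions (r + 1)) f

lemma functions_cases (f : (L[[Fin n]]).Functions 0) : ∃ i, f = L.con i := by
  rcases f with f | f
  · exact isEmptyElim f
  · exact ⟨f, rfl⟩

lemma no_functions {r : ℕ} (f : (L.sum (unaryLang n)).Functions r) : False := by
  rcases f with f | f
  · exact isEmptyElim f
  · exact Empty.elim f

/-- Build a homomorphism into `B^c`. -/
lemma hom_cc_iff (D B : Type) [(L.sum (unaryLang n)).Structure D] [(L[[Fin n]]).Structure B] :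
    Nonempty (@Language.Hom (L.sum (unaryLang n)) D B _ (ccStruct L n B)) ↔
      ∃ f : D → B,
        (∀ (r : ℕ) (R : L.Relations r) (x : Fin r → D),
          Structure.RelMap (L := L.sum (unaryLang n)) (Sum.inl R) x →
          Structure.RelMap (L := L[[Fin n]]) (Sum.inl R) (f ∘ x)) ∧
        ∀ (i : Fin n) (x : Fin 1 → D), Structure.RelMap (unSym L i) x → f (x 0) = cstOf L B i := by
  letI := ccStruct L n B
  constructor
  · rintro ⟨g⟩
    refine ⟨g.toFun, fun r R x h => g.map_rel' _ x h, fun i x h => g.map_rel' _ x h⟩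
  · rintro ⟨f, h1, h2⟩
    refine ⟨⟨f, fun g => (no_functions g).elim, ?_⟩⟩
    intro r R x h
    rcases R with R | R
    · exact h1 r R x h
    · match r, R, x, h with
      | 1, i, x, h => exact h2 i x h
      | 0, i, x, h => exact Empty.elim i
      | _ + 2, i, x, h => exact Empty.elim i

lemma hom_c_iff (D B : Type) [(L[[Fin n]]).Structure D] [(L[[Fin n]]).Structure B] :
    Nonempty (Language.Hom (L[[Fin n]]) D B) ↔
      ∃ f : D → B,
        (∀ (r : ℕ) (R : L.Relations r) (x : Fin r → D),
          Structure.RelMap (L := L[[Fin n]]) (Sum.inl R) x →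
          Structure.RelMap (L := L[[Fin n]]) (Sum.inl R) (f ∘ x)) ∧
        ∀ (i : Fin n), f (cstOf L D i) = cstOf L B i := by
  constructor
  · rintro ⟨g⟩
    refine ⟨g.toFun, fun r R x h => g.map_rel' _ x h, fun i => ?_⟩
    refine (g.map_fun' (L.con i) Fin.elim0).trans ?_
    exact congrArg _ (Subsingleton.elim _ _)
  · rintro ⟨f, h1, h2⟩
    refine ⟨⟨f, ?_, ?_⟩⟩
    · intro r g x
      obtain rfl := arity_zero g
      obtain ⟨i, rfl⟩ := functions_cases g
      rw [Subsingleton.elim x Fin.elim0, Subsingleton.elim (f ∘ Fin.elim0) Fin.elim0]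
      exact h2 i
    · intro r R x h
      rcases R with R | R
      · exact h1 r R x h
      · exact Empty.elim R

/-! ### From `L_P` to `L_c` -/

lemma term_sum {α : Type*} (t : (L.sum (unaryLang n)).Term α) : ∃ a, t = .var a := by
  cases t with
  | var a => exact ⟨a, rfl⟩
  | func f _ => exact (no_functions f).elim

lemma translate_back {k : ℕ} (ψ : (L.sum (unaryLang n)).BoundedFormula Empty k) :
    ∃ φ : (L[[Fin n]]).BoundedFormula Empty k,
      ∀ (D : Type) [(L[[Fin n]]).Structure D] (e : Empty → D) (v : Fin k → D),
        φ.Realize e v ↔ @BoundedFormula.Realize _ D (ccStruct L n D) _ _ ψ e v := by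
  induction ψ with
  | falsum => exact ⟨.falsum, fun D _ e v => Iff.rfl⟩
  | equal t₁ t₂ =>
    obtain ⟨a, rfl⟩ := term_sum t₁
    obtain ⟨b, rfl⟩ := term_sum t₂
    exact ⟨.equal (.var a) (.var b), fun D _ e v => Iff.rfl⟩
  | @rel k r R ts =>
    choose a ha using fun i => term_sum (ts i)
    obtain rfl : ts = fun i => .var (a i) := funext ha
    rcases R with R | R
    · exact ⟨.rel (L := L[[Fin n]]) (Sum.inl R) (fun i => .var (a i)), fun D _ e v => Iff.rfl⟩
    · match r, R, a with
      | 1, i, a =>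
        refine ⟨.equal (.var (a 0)) (.func (L.con i) Fin.elim0), fun D _ e v => ?_⟩
        have : (fun j : Fin 0 => Term.realize (L := L[[Fin n]]) (Sum.elim e v)
          (Fin.elim0 j : (L[[Fin n]]).Term (Empty ⊕ Fin k))) = Fin.elim0 :=
          Subsingleton.elim _ _
        change Sum.elim e v (a 0) = Structure.funMap _ _ ↔ Sum.elim e v (a 0) = Structure.funMap _ _
        rw [this]
      | 0, i, a => exact Empty.elim i
      | _ + 2, i, a => exact Empty.elim i
  | imp f g hf hg =>
    obtain ⟨f', hf'⟩ := hf
    obtain ⟨g', hg'⟩ := hg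
    exact ⟨f'.imp g', fun D _ e v => imp_congr (hf' D e v) (hg' D e v)⟩
  | all f hf =>
    obtain ⟨f', hf'⟩ := hf
    exact ⟨f'.all, fun D _ e v => forall_congr' fun x => hf' D e _⟩

/-! ### From `L_c` to `L_P` -/

/-- The graph of the gluing map. -/
def glueRel (D B : Type) [(L.sum (unaryLang n)).Structure D] [(L[[Fin n]]).Structure B]
    (x : D) : D ⊕ B → Prop
  | Sum.inl y => x = y ∧ ∀ i : Fin n, ¬ Structure.RelMap (unSym L i) (fun _ : Fin 1 => x)
  | Sum.inr b => ∃ i : Fin n, Structure.RelMap (unSym L i) (fun _ : Fin 1 => x) ∧ cstOf L B i = b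

/-- The structure `D` glued with `B`. -/
@[reducible] noncomputable def glueStr (D B : Type) [Nonempty B]
    [(L.sum (unaryLang n)).Structure D]
    [(L[[Fin n]]).Structure B] : (L[[Fin n]]).Structure (D ⊕ B) where
  funMap := fun f _ => Sum.inr (Structure.funMap f fun _ => Classical.arbitrary B)
  RelMap := fun {r} R z =>
    match R with
    | Sum.inl R =>
      (∃ b : Fin r → B, z = Sum.inr ∘ b ∧ Structure.RelMap (L := L[[Fin n]]) (Sum.inl R) b) ∨
      ∃ y : Fin r → D, Structure.RelMap (L := L.sum (unaryLang n)) (Sum.inl R) y ∧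
        ∀ l, glueRel (L := L) (n := n) D B (y l) (z l)
    | Sum.inr R => Empty.elim R

/-- No element lies in two predicates naming different constants of `B`. -/
def Consis (L : Language) (n : ℕ) (D B : Type) [(L.sum (unaryLang n)).Structure D]
    [(L[[Fin n]]).Structure B] : Prop :=
  ∀ (i j : Fin n) (x : D), Structure.RelMap (unSym L i) (fun _ : Fin 1 => x) →
    Structure.RelMap (unSym L j) (fun _ : Fin 1 => x) → cstOf L B i = cstOf L B j

lemma fin1 {D : Type} (x : Fin 1 → D) : x = fun _ => x 0 := by
  funext i; rw [Subsingleton.elim i 0]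

lemma glue_cst (D B : Type) [Nonempty B] [(L.sum (unaryLang n)).Structure D]
    [(L[[Fin n]]).Structure B] (i : Fin n) :
    @cstOf L n (D ⊕ B) (glueStr D B) i = Sum.inr (cstOf L B i) := by
  change Sum.inr _ = Sum.inr _
  exact congrArg _ (congrArg _ (Subsingleton.elim _ _))

lemma glue_hom_iff (D B C : Type) [Nonempty B] [(L.sum (unaryLang n)).Structure D]
    [(L[[Fin n]]).Structure B] [(L[[Fin n]]).Structure C] (hc : Consis L n D B) :
    Nonempty (@Language.Hom (L[[Fin n]]) (D ⊕ B) C (glueStr D B) _) ↔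
      Nonempty (@Language.Hom (L.sum (unaryLang n)) D C _ (ccStruct L n C)) ∧
      Nonempty (Language.Hom (L[[Fin n]]) B C) := by
  letI := glueStr (L := L) (n := n) D B
  rw [hom_c_iff, hom_c_iff, hom_cc_iff]
  constructor
  · rintro ⟨g, h1, h2⟩
    have hex : ∀ x : D, ∃ z, glueRel (L := L) (n := n) D B x z := by
      intro x
      by_cases h : ∃ i : Fin n, Structure.RelMap (unSym L i) (fun _ : Fin 1 => x)
      · obtain ⟨i, hi⟩ := h
        exact ⟨Sum.inr (cstOf L B i), i, hi, rfl⟩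
      · exact ⟨Sum.inl x, rfl, fun i hi => h ⟨i, hi⟩⟩
    choose ρ hρ using hex
    refine ⟨⟨g ∘ ρ, ?_, ?_⟩, ⟨g ∘ Sum.inr, ?_, ?_⟩⟩
    · intro r R x h
      exact h1 r R (ρ ∘ x) (Or.inr ⟨x, h, fun l => hρ _⟩)
    · intro i x h
      rw [fin1 x] at h
      have : ρ (x 0) = Sum.inr (cstOf L B i) := by
        have h3 := hρ (x 0)
        generalize ρ (x 0) = z at h3
        rcases z with y | b
        · exact absurd h (h3.2 i)
        · obtain ⟨j, hj, rfl⟩ := h3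
          rw [hc i j _ h hj]
      change g (ρ (x 0)) = _
      rw [this, ← h2 i, glue_cst]
    · intro r R x h
      exact h1 r R (Sum.inr ∘ x) (Or.inl ⟨x, rfl, h⟩)
    · intro i
      rw [← h2 i, glue_cst]; rfl
  · rintro ⟨⟨f, h1, h2⟩, ⟨g, h3, h4⟩⟩
    refine ⟨Sum.elim f g, ?_, ?_⟩
    · intro r R x h
      rcases h with ⟨b, rfl, hb⟩ | ⟨y, hy, hz⟩
      · exact h3 r R b hb
      · have : Sum.elim f g ∘ x = f ∘ y := by
          funext l
          have h5 := hz l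
          change Sum.elim f g (x l) = f (y l)
          generalize x l = z at h5
          rcases z with z | b
          · rw [h5.1]; rfl
          · obtain ⟨i, hi, rfl⟩ := h5
            exact (h4 i).trans (h2 i _ hi).symm
        rw [this]
        exact h1 r R y hy
    · intro i
      rw [glue_cst]
      exact h4 i

/-- Value of a variable under a static assignment. -/
def valOf {D B : Type} {k : ℕ} (s : Fin k → Option B) (v : Fin k → D) (i : Fin k) : D ⊕ B :=
  (s i).elim (Sum.inl (v i)) Sum.inr

lemma term_glue (B : Type) [Nonempty B] [(L[[Fin n]]).Structure B] {k : ℕ}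
    (t : (L[[Fin n]]).Term (Empty ⊕ Fin k)) (s : Fin k → Option B) :
    ∃ κ : Fin k ⊕ B, ∀ (D : Type) [(L.sum (unaryLang n)).Structure D] (e : Empty → D ⊕ B)
      (v : Fin k → D),
      @Term.realize _ (D ⊕ B) (glueStr D B) _ (Sum.elim e (valOf s v)) t = Sum.map v id κ := by
  cases t with
  | var a =>
    rcases a with a | a
    · exact a.elim
    · rcases h : s a with _ | b
      · refine ⟨Sum.inl a, fun D _ e v => ?_⟩
        simp [valOf, h]
      · refine ⟨Sum.inr b, fun D _ e v => ?_⟩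
        simp [valOf, h]
  | func f ts =>
    exact ⟨Sum.inr (Structure.funMap f fun _ => Classical.arbitrary B), fun D _ e v => rfl⟩

/-- Formula for the gluing graph. -/
lemma glue_formula (B : Type) [(L[[Fin n]]).Structure B] {α : Type} (a : α) (κ : α ⊕ B) :
    ∃ χ : (L.sum (unaryLang n)).Formula α,
      ∀ (D : Type) [(L.sum (unaryLang n)).Structure D] (v : α → D),
        χ.Realize v ↔ glueRel (L := L) (n := n) D B (v a) (Sum.map v id κ) := by
  have hP : ∀ (i : Fin n) (D : Type) [(L.sum (unaryLang n)).Structure D] (v : α → D),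
      ((unSym L i).formula (fun _ : Fin 1 => (Term.var a))).Realize v ↔
        Structure.RelMap (unSym L i) (fun _ : Fin 1 => v a) := by
    intro i D _ v
    rw [Formula.realize_rel]; rfl
  rcases κ with b | b
  · refine ⟨(Term.equal (.var a) (.var b)) ⊓ Formula.iInf (fun i : Fin n =>
      ((unSym L i).formula (fun _ : Fin 1 => (Term.var a))).not), fun D _ v => ?_⟩
    rw [Formula.realize_inf, Formula.realize_iInf, Formula.realize_equal]
    simp only [Formula.realize_not, hP]
    rfl
  · classical
    refine ⟨Formula.iSup (fun i : {i : Fin n // cstOf L B i = b} =>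
      ((unSym L i.1).formula (fun _ : Fin 1 => (Term.var a)))), fun D _ v => ?_⟩
    rw [Formula.realize_iSup]
    simp only [hP]
    constructor
    · rintro ⟨⟨i, hi⟩, h⟩; exact ⟨i, h, hi⟩
    · rintro ⟨i, h, hi⟩; exact ⟨⟨i, hi⟩, h⟩

lemma const_formula (α : Type) (p : Prop) :
    ∃ χ : (L.sum (unaryLang n)).Formula α,
      ∀ (D : Type) [(L.sum (unaryLang n)).Structure D] (v : α → D), χ.Realize v ↔ p := by
  by_cases h : p
  · exact ⟨⊤, fun D _ v => by simp [h]⟩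
  · exact ⟨⊥, fun D _ v => by simp [h]⟩

lemma translate_glue (B : Type) [Nonempty B] [Finite B] [(L[[Fin n]]).Structure B] {k : ℕ}
    (φ : (L[[Fin n]]).BoundedFormula Empty k) : ∀ (s : Fin k → Option B),
    ∃ χ : (L.sum (unaryLang n)).Formula (Fin k),
      ∀ (D : Type) [Nonempty D] [(L.sum (unaryLang n)).Structure D] (e : Empty → D ⊕ B)
        (v : Fin k → D), χ.Realize v ↔
          @BoundedFormula.Realize _ (D ⊕ B) (glueStr D B) _ _ φ e (valOf s v) := by
  induction φ with
  | falsum => exact fun s => ⟨⊥, fun D _ _ e v => Iff.rfl⟩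
  | @equal k t₁ t₂ =>
    intro s
    obtain ⟨a, ha⟩ := term_glue B t₁ s
    obtain ⟨b, hb⟩ := term_glue B t₂ s
    suffices h : ∃ χ : (L.sum (unaryLang n)).Formula (Fin k),
        ∀ (D : Type) [(L.sum (unaryLang n)).Structure D] 
          (v : Fin k → D), χ.Realize v ↔ Sum.map v id a = Sum.map v id b by
      obtain ⟨χ, hχ⟩ := h
      refine ⟨χ, fun D _ _ e v => ?_⟩
      rw [hχ, ← ha D e v, ← hb D e v]; rfl
    rcases a with a | a <;> rcases b with b | b
    · exact ⟨Term.equal (.var a) (.var b), fun D _ v => by simp [Formula.realize_equal]⟩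
    · exact ⟨⊥, fun D _ v => by simp⟩
    · exact ⟨⊥, fun D _ v => by simp⟩
    · obtain ⟨χ, hχ⟩ := const_formula (L := L) (n := n) (Fin k) (a = b)
      exact ⟨χ, fun D _ v => by rw [hχ]; simp⟩
  | @rel k r R ts =>
    intro s
    choose κ hκ using fun i => term_glue B (ts i) s
    rcases R with R | R
    swap
    · exact Empty.elim R
    obtain ⟨χ₁, h₁⟩ := const_formula (L := L) (n := n) (Fin k)
      (∃ b : Fin r → B, κ = Sum.inr ∘ b ∧ Structure.RelMap (L := L[[Fin n]]) (Sum.inl R) b)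
    choose χ₂ h₂ using fun l : Fin r => glue_formula (L := L) (n := n) B
      (α := Fin k ⊕ Fin r) (Sum.inr l) (Sum.map Sum.inl id (κ l))
    refine ⟨χ₁ ⊔ Formula.iExs (Fin r) (Relations.formula
      (L := L.sum (unaryLang n)) (Sum.inl R : (L.sum (unaryLang n)).Relations r)
        (fun l => Term.var (Sum.inr l)) ⊓ Formula.iInf χ₂), fun D _ _ e v => ?_⟩
    rw [Formula.realize_sup, h₁, Formula.realize_iExs]
    simp only [Formula.realize_inf, Formula.realize_iInf, h₂, Formula.realize_rel]
    change _ ↔ (∃ b : Fin r → B, _ = Sum.inr ∘ b ∧ _) ∨ ∃ y : Fin r → D, _ ∧ ∀ l, glueRel D B _ _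
    refine or_congr (exists_congr fun b => and_congr_left' ?_)
      (exists_congr fun y => and_congr Iff.rfl (forall_congr' fun l => ?_))
    · simp only [funext_iff, hκ]
      refine forall_congr' fun l => ?_
      rcases κ l with z | z <;> simp
    · rw [hκ]
      rcases κ l with z | z <;> rfl
  | imp f g hf hg =>
    intro s
    obtain ⟨f', hf'⟩ := hf s
    obtain ⟨g', hg'⟩ := hg s
    exact ⟨f'.imp g', fun D _ _ e v => by
      rw [Formula.realize_imp]; exact imp_congr (hf' D e v) (hg' D e v)⟩
  | @all k f hf =>
    intro s
    choose χ hχ using fun o : Option B => hf (Fin.snoc s o)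
    let ρ : Fin (k + 1) → Fin k ⊕ Unit := Fin.snoc (fun i => Sum.inl i) (Sum.inr ())
    refine ⟨Formula.iInf fun o : Option B => Formula.iAlls Unit ((χ o).relabel ρ),
      fun D _ _ e v => ?_⟩
    have hρ : ∀ u : Unit → D, (fun a => Sum.elim v u a) ∘ ρ = Fin.snoc v (u ()) := by
      intro u
      funext i
      refine Fin.lastCases ?_ (fun i => ?_) i <;> simp [ρ]
    have hv : ∀ (o : Option B) (x : D), valOf (Fin.snoc s o) (Fin.snoc v x) =
        (Fin.snoc (valOf s v) (o.elim (Sum.inl x) Sum.inr) : Fin (k + 1) → D ⊕ B) := by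
      intro o x
      funext i
      refine Fin.lastCases ?_ (fun i => ?_) i <;> simp [valOf]
    rw [Formula.realize_iInf]
    simp only [Formula.realize_iAlls, Formula.realize_relabel, hρ]
    have hχ' := fun o => hχ o D e
    simp only [hχ', hv]
    constructor
    · rintro h (x | b)
      · exact h none (fun _ => x)
      · exact h (some b) (fun _ => Classical.arbitrary D)
    · intro h o u
      exact h _

lemma consis_formula (B : Type) [(L[[Fin n]]).Structure B] :
    ∃ χ : (L.sum (unaryLang n)).Sentence,
      ∀ (D : Type) [(L.sum (unaryLang n)).Structure D], D ⊨ χ ↔ Consis L n D B := by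
  choose χ hχ using fun p : Fin n × Fin n =>
    const_formula (L := L) (n := n) (Empty ⊕ Unit) (cstOf L B p.1 = cstOf L B p.2)
  refine ⟨Formula.iInf fun p : Fin n × Fin n => Formula.iAlls Unit
    (((unSym L p.1).formula (fun _ : Fin 1 => Term.var (Sum.inr ()))).imp
      (((unSym L p.2).formula (fun _ : Fin 1 => Term.var (Sum.inr ()))).imp (χ p))),
    fun D _ => ?_⟩
  rw [Sentence.Realize, Formula.realize_iInf]
  simp only [Formula.realize_iAlls, Formula.realize_imp, hχ, Formula.realize_rel]
  constructor
  · intro h i j x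
    exact h (i, j) (fun _ => x)
  · intro h p u
    exact h p.1 p.2 (u ())

lemma consis_of_hom (D B : Type) [(L.sum (unaryLang n)).Structure D] [(L[[Fin n]]).Structure B]
    (h : Nonempty (@Language.Hom (L.sum (unaryLang n)) D B _ (ccStruct L n B))) :
    Consis L n D B := by
  obtain ⟨f, -, h2⟩ := (hom_cc_iff D B).1 h
  intro i j x hi hj
  rw [← h2 i _ hi, ← h2 j _ hj]

lemma cc_hom_iff (D B : Type) [(L[[Fin n]]).Structure D] [(L[[Fin n]]).Structure B] :
    Nonempty (@Language.Hom (L.sum (unaryLang n)) D B (ccStruct L n D) (ccStruct L n B)) ↔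
      Nonempty (Language.Hom (L[[Fin n]]) D B) := by
  letI := ccStruct L n D
  rw [hom_cc_iff, hom_c_iff]
  refine exists_congr fun f => and_congr Iff.rfl (forall_congr' fun i => ?_)
  constructor
  · intro h
    exact h (fun _ => cstOf L D i) rfl
  · intro h x hx
    have hx' : x 0 = cstOf L D i := hx
    rw [hx', h]

end Helpers

/-- Let `L` be a finite relational language, `n ≥ 1`, `L_c = L[[Fin n]]`,
and `L_P` the extension of `L` by `n` fresh unary relation symbols.  Let `B₁, …, B_m`
(given as `F : Fin m → Type`) be finite nonempty `L_c`-structures that are pairwise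
homomorphically incomparable.  Then `coCSP({B₁, …, B_m})` is FO-definable (by an
`L_c`-sentence over finite nonempty `L_c`-structures) iff for each `i`, `coCSP(Bᵢ^c)` is
FO-definable (by an `L_P`-sentence over finite nonempty `L_P`-structures). -/
theorem coCSP_FODefinable_iff_forall_constantFree_FODefinable
    (L : Language) [L.IsRelational] [Finite L.Symbols] (n : ℕ) (hn : 1 ≤ n)
    (m : ℕ) (F : Fin m → Type)
    [∀ i, Finite (F i)] [∀ i, Nonempty (F i)] [∀ i, (L[[Fin n]]).Structure (F i)]
    (hinc : ∀ i j, i ≠ j → IsEmpty (Language.Hom (L[[Fin n]]) (F i) (F j))) :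
    (∃ φ : (L[[Fin n]]).Sentence,
      ∀ (D : Type) [Finite D] [Nonempty D] [(L[[Fin n]]).Structure D],
        D ⊨ φ ↔ ∀ i, IsEmpty (Language.Hom (L[[Fin n]]) D (F i))) ↔
    (∀ i, ∃ ψ : (L.sum (unaryLang n)).Sentence,
      ∀ (D : Type) [Finite D] [Nonempty D] [(L.sum (unaryLang n)).Structure D],
        D ⊨ ψ ↔
          IsEmpty (@Language.Hom (L.sum (unaryLang n)) D (F i) _ (ccStruct L n (F i)))) := by
  constructor
  · rintro ⟨φ, hφ⟩ i
    obtain ⟨χ₁, h₁⟩ := consis_formula (L := L) (n := n) (F i)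
    obtain ⟨χ₂, h₂⟩ := translate_glue (L := L) (n := n) (F i) φ Fin.elim0
    refine ⟨χ₁.imp (χ₂.relabel Fin.elim0), fun D _ _ _ => ?_⟩
    letI := glueStr (L := L) (n := n) D (F i)
    have h3 : D ⊨ (χ₁.imp (χ₂.relabel Fin.elim0) : (L.sum (unaryLang n)).Sentence) ↔
        (D ⊨ χ₁ → (D ⊕ F i) ⊨ φ) := by
      rw [Language.Sentence.Realize, Language.Formula.realize_imp]
      refine imp_congr Iff.rfl ?_
      rw [Language.Formula.realize_relabel, h₂ D default]
      rw [Language.Sentence.Realize, Language.Formula.Realize]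
      exact iff_of_eq (congrArg _ (Subsingleton.elim _ _))
    rw [h3, h₁, hφ, ← not_nonempty_iff]
    constructor
    · intro h hne
      have hc := consis_of_hom D (F i) hne
      exact not_nonempty_iff.2 (h hc i)
        ((glue_hom_iff D (F i) (F i) hc).2 ⟨hne, ⟨Language.Hom.id _ _⟩⟩)
    · intro h hc j
      rw [← not_nonempty_iff, glue_hom_iff D (F i) (F j) hc]
      rintro ⟨hD, hB⟩
      by_cases hij : i = j
      · subst hij; exact h hD
      · exact not_nonempty_iff.2 (hinc i j hij) hB
  · intro h
    choose ψ hψ using h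
    choose φ hφ using fun i => translate_back (L := L) (n := n) (ψ i)
    refine ⟨Language.Formula.iInf φ, fun D _ _ _ => ?_⟩
    rw [Language.Sentence.Realize, Language.Formula.realize_iInf]
    refine forall_congr' fun i => ?_
    have h1 := @hψ i D _ _ (ccStruct L n D)
    rw [← not_nonempty_iff, cc_hom_iff, not_nonempty_iff] at h1
    rw [← h1]
    exact hφ i D _ _
end
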